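/- arXiv:1704.02515 — 7 statements merged into one kernel-verified Lean document; each statement's English description precedes it below -/
import Mathlib

section
/- Let P be a finite set of points in ℝ^d, let k ≥ 1, and suppose P is partitioned into k pairwise disjoint clusters C_1, …, C_k such that for some centers c_1, …, c_k ∈ ℝ^d and some r_opt ≥ 0 one has dist(p, c_j) ≤ r_opt for every p ∈ C_j and every j. Let s_1, …, s_k ∈ P satisfy the farthest-point (greedy) property: for every j with 2 ≤ j ≤ k and every p ∈ P, min_{1 ≤ l ≤ j−1} dist(s_j, s_l) ≥ min_{1 ≤ l ≤ j−1} dist(p, s_l). Then there exists a function f : {1, …, k} → {s_1, …, s_k} such that for every j and every p ∈ C_j, dist(p, f(j)) ≤ 4·r_opt. In particular, assigning each whole cluster C_j to center f(j) yields a clustering with the same cluster sizes whose radius is at most 4·r_opt. -/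
/-- Lemma 1 of the paper: given an optimal balanced clustering of radius `r_opt` and
points `s 0, …, s (k-1)` selected by Gonzalez's farthest-point procedure, there is an
assignment of a candidate center (one of the `s i`) to each optimal cluster so that
every point of the `j`-th cluster is within distance `4 * r_opt` of its assigned
candidate center. -/
theorem stmt_0 (d k : ℕ) (hk : 1 ≤ k)
    (P : Finset (EuclideanSpace ℝ (Fin d)))
    (C : Fin k → Finset (EuclideanSpace ℝ (Fin d)))
    (hPart : ∀ p, p ∈ P ↔ ∃ j, p ∈ C j)
    (hDisj : ∀ i j : Fin k, i ≠ j → Disjoint (C i) (C j))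
    (c : Fin k → EuclideanSpace ℝ (Fin d)) (r_opt : ℝ) (hr : 0 ≤ r_opt)
    (hRad : ∀ j : Fin k, ∀ p ∈ C j, dist p (c j) ≤ r_opt)
    (s : Fin k → EuclideanSpace ℝ (Fin d)) (hs : ∀ j, s j ∈ P)
    (hGreedy : ∀ j : Fin k, (j : ℕ) ≠ 0 → ∀ p ∈ P,
      sInf ((fun l => dist p (s l)) '' {l : Fin k | l < j}) ≤
        sInf ((fun l => dist (s j) (s l)) '' {l : Fin k | l < j})) :
    ∃ f : Fin k → EuclideanSpace ℝ (Fin d),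
      (∀ j : Fin k, ∃ i : Fin k, f j = s i) ∧
      ∀ j : Fin k, ∀ p ∈ C j, dist p (f j) ≤ 4 * r_opt := by
  have hpair : ∀ j : Fin k, ∀ p ∈ C j, ∀ q ∈ C j, dist p q ≤ 2 * r_opt := by
    intro j p hp q hq
    have h1 := hRad j p hp
    have h2 := hRad j q hq
    have h3 := dist_triangle_right p q (c j)
    linarith
  have hex : ∀ i, ∃ j, s i ∈ C j := fun i => (hPart _).1 (hs i)
  choose g hg using hex
  have key : ∀ j : Fin k, ∃ i : Fin k, ∀ p ∈ C j, dist p (s i) ≤ 4 * r_opt := by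
    by_cases hinj : Function.Injective g
    · intro j
      obtain ⟨i, hi⟩ := (Finite.injective_iff_surjective.1 hinj) j
      refine ⟨i, fun p hp => ?_⟩
      have := hpair j p hp (s i) (hi ▸ hg i)
      linarith
    · have hab : ∃ a b, a < b ∧ g a = g b := by
        simp only [Function.Injective, not_forall] at hinj
        obtain ⟨a, b, h, hne⟩ := hinj
        rcases lt_or_gt_of_ne hne with h1 | h1
        · exact ⟨a, b, h1, h⟩
        · exact ⟨b, a, h1, h.symm⟩
      obtain ⟨a, b, hlt, hgab⟩ := hab
      have hb0 : (b : ℕ) ≠ 0 := by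
        have : (a : ℕ) < b := hlt
        omega
      have hsb : sInf ((fun l => dist (s b) (s l)) '' {l : Fin k | l < b}) ≤ 2 * r_opt := by
        have hm : dist (s b) (s a) ∈ (fun l => dist (s b) (s l)) '' {l : Fin k | l < b} :=
          ⟨a, hlt, rfl⟩
        refine (csInf_le (Set.toFinite _).bddBelow hm).trans ?_
        exact hpair (g b) _ (hg b) _ (hgab ▸ hg a)
      intro j
      rcases (C j).eq_empty_or_nonempty with he | ⟨q, hq⟩
      · exact ⟨a, by simp [he]⟩
      · have h1 := hGreedy b hb0 q ((hPart q).2 ⟨j, hq⟩)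
        have hne : ((fun l => dist q (s l)) '' {l : Fin k | l < b}).Nonempty :=
          ⟨_, a, hlt, rfl⟩
        obtain ⟨l, -, hl⟩ := hne.csInf_mem (Set.toFinite _)
        refine ⟨l, fun p hp => ?_⟩
        have h2 := hpair j p hp q hq
        have h3 := dist_triangle p q (s l)
        simp only at hl
        linarith
  choose f hf using key
  exact ⟨fun j => s (f j), fun j => ⟨f j, rfl⟩, hf⟩
end

section
/- Let P be a finite set of points in ℝ^d, let k ≥ 1 and let L ≤ U be positive integers. Suppose there exists a balanced clustering of P of radius r_opt, i.e. a partition of P into clusters C_1, …, C_k with L ≤ |C_j| ≤ U together with centers c_1, …, c_k ∈ ℝ^d such that dist(p, c_j) ≤ r_opt for every p ∈ C_j. Let s_1, …, s_k ∈ P satisfy the farthest-point (greedy) property: for every j with 2 ≤ j ≤ k and every p ∈ P, min_{1 ≤ l ≤ j−1} dist(s_j, s_l) ≥ min_{1 ≤ l ≤ j−1} dist(p, s_l). Then there exist centers q_1, …, q_k ∈ {s_1, …, s_k} (repetitions allowed) and an assignment σ : P → {1, …, k} with L ≤ |σ^{−1}(j)| ≤ U for every j, such that dist(p, q_{σ(p)})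 ≤ 4·r_opt for every p ∈ P. -/
/-- Theorem 1 of the paper (approximation guarantee): if a balanced clustering of `P`
of radius `r_opt` exists (clusters of sizes between `L` and `U`), and `s 0, …, s (k-1)`
are points of `P` satisfying the farthest-point (greedy) property, then there are
centers chosen among the `s i` (repetitions allowed) and a balanced assignment of the
points to these centers of radius at most `4 * r_opt`. -/
theorem stmt_2 (d k : ℕ) (hk : 1 ≤ k) (L U : ℕ) (hL : 1 ≤ L) (hLU : L ≤ U)
    (P : Finset (EuclideanSpace ℝ (Fin d)))
    (C : Fin k → Finset (EuclideanSpace ℝ (Fin d)))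
    (hPart : ∀ p, p ∈ P ↔ ∃ j, p ∈ C j)
    (hDisj : ∀ i j : Fin k, i ≠ j → Disjoint (C i) (C j))
    (hSize : ∀ j : Fin k, L ≤ (C j).card ∧ (C j).card ≤ U)
    (c : Fin k → EuclideanSpace ℝ (Fin d)) (r_opt : ℝ) (hr : 0 ≤ r_opt)
    (hRad : ∀ j : Fin k, ∀ p ∈ C j, dist p (c j) ≤ r_opt)
    (s : Fin k → EuclideanSpace ℝ (Fin d)) (hs : ∀ j, s j ∈ P)
    (hGreedy : ∀ j : Fin k, (j : ℕ) ≠ 0 → ∀ p ∈ P,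
      sInf ((fun l => dist p (s l)) '' {l : Fin k | l < j}) ≤
        sInf ((fun l => dist (s j) (s l)) '' {l : Fin k | l < j})) :
    ∃ (q : Fin k → EuclideanSpace ℝ (Fin d)) (σ : {p // p ∈ P} → Fin k),
      (∀ j : Fin k, ∃ i : Fin k, q j = s i) ∧
      (∀ j : Fin k,
        L ≤ ((Finset.univ : Finset {p // p ∈ P}).filter (fun p => σ p = j)).card ∧
        ((Finset.univ : Finset {p // p ∈ P}).filter (fun p => σ p = j)).card ≤ U) ∧
      ∀ p : {p // p ∈ P}, dist p.1 (q (σ p)) ≤ 4 * r_opt := by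
  have hpair : ∀ j, ∀ x ∈ C j, ∀ y ∈ C j, dist x y ≤ 2 * r_opt := by
    intro j x hx y hy
    have h1 := hRad j x hx
    have h2 := hRad j y hy
    have h3 := dist_triangle_right x y (c j)
    linarith
  have key : ∀ p ∈ P, ∃ i, dist p (s i) ≤ 2 * r_opt := by
    intro p hp
    by_contra! hfar
    have hsep : ∀ j l : Fin k, l < j → 2 * r_opt < dist (s j) (s l) := by
      intro j l hlj
      have hj : (j : ℕ) ≠ 0 := by
        have : (l : ℕ) < j := hlj
        omega
      have hg := hGreedy j hj p hp
      have hne : ((fun l => dist p (s l)) '' {l : Fin k | l < j}).Nonempty :=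
        ⟨_, l, hlj, rfl⟩
      obtain ⟨m, -, hm⟩ := hne.csInf_mem (Set.toFinite _)
      have h2 : sInf ((fun l => dist (s j) (s l)) '' {l : Fin k | l < j}) ≤ dist (s j) (s l) :=
        csInf_le (Set.toFinite _).bddBelow ⟨l, hlj, rfl⟩
      have h3 := hfar m
      simp only at hm
      rw [← hm] at hg
      linarith
    choose f hf using fun j => (hPart (s j)).1 (hs j)
    have hinj : Function.Injective f := by
      intro a b hab
      by_contra hne
      have h1 := hpair (f a) (s a) (hf a) (s b) (hab ▸ hf b)
      rcases lt_or_gt_of_ne hne with h | h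
      · have := hsep b a h
        rw [dist_comm] at this
        linarith
      · have := hsep a b h
        linarith
    obtain ⟨j, hj⟩ := (hPart p).1 hp
    obtain ⟨i, rfl⟩ := (Finite.injective_iff_surjective.1 hinj) j
    have h1 := hpair _ p hj _ (hf i)
    have h2 := hfar i
    linarith
  have hcl : ∀ j, ∃ i, ∀ p ∈ C j, dist p (s i) ≤ 4 * r_opt := by
    intro j
    have hpos : 0 < (C j).card := lt_of_lt_of_le hL (hSize j).1
    obtain ⟨x, hx⟩ := Finset.card_pos.1 hpos
    obtain ⟨i, hi⟩ := key x ((hPart x).2 ⟨j, hx⟩)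
    refine ⟨i, fun p hp => ?_⟩
    have h1 := hpair j p hp x hx
    have h2 := dist_triangle p x (s i)
    linarith
  choose g hg using hcl
  choose σ hσ using fun p : {p // p ∈ P} => (hPart p.1).1 p.2
  refine ⟨fun j => s (g j), σ, fun j => ⟨g j, rfl⟩, fun j => ?_, fun p => hg _ _ (hσ p)⟩
  have hcard : ((Finset.univ : Finset {p // p ∈ P}).filter (fun p => σ p = j)).card
      = (C j).card := by
    refine Finset.card_bij (fun p _ => p.1) ?_ ?_ ?_
    · intro p hp
      have h := (Finset.mem_filter.1 hp).2
      exact h ▸ hσ p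
    · intro a _ b _ h
      exact Subtype.ext h
    · intro b hb
      have hbP : b ∈ P := (hPart b).2 ⟨j, hb⟩
      refine ⟨⟨b, hbP⟩, Finset.mem_filter.2 ⟨Finset.mem_univ _, ?_⟩, rfl⟩
      by_contra hne
      exact Finset.disjoint_left.1 (hDisj _ _ hne) (hσ ⟨b, hbP⟩) hb
  rw [hcard]
  exact hSize j
end

section
/- Let X be a metric space, let P be a finite set of points in X, let k ≥ 1 and let L ≤ U be positive integers. Suppose there exists a balanced clustering of P of radius r_opt, i.e. a partition of P into clusters C_1, …, C_k with L ≤ |C_j| ≤ U together with centers c_1, …, c_k ∈ X such that dist(p, c_j) ≤ r_opt for every p ∈ C_j. Let s_1, …, s_k ∈ P satisfy the farthest-point (greedy) property: for every j with 2 ≤ j ≤ k and every p ∈ P, min_{1 ≤ l ≤ j−1} dist(s_j, s_l) ≥ min_{1 ≤ l ≤ j−1} dist(p, s_l). Then there exist centers q_1, …, q_k ∈ {s_1, …, s_k} (repetitions allowed) and an assignment σ : P → {1, …, k} with L ≤ |σ^{−1}(j)| ≤ U for every j, such that dist(p, q_{σ(p)}) ≤ 4·r_opt for every p ∈ P. 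-/
/-- Corollary 1 of the paper: the 4-approximation guarantee for balanced k-center
clustering holds in an arbitrary metric space. -/
theorem stmt_3 {X : Type*} [MetricSpace X] (k : ℕ) (hk : 1 ≤ k)
    (L U : ℕ) (hL : 1 ≤ L) (hLU : L ≤ U)
    (P : Finset X)
    (C : Fin k → Finset X)
    (hPart : ∀ p, p ∈ P ↔ ∃ j, p ∈ C j)
    (hDisj : ∀ i j : Fin k, i ≠ j → Disjoint (C i) (C j))
    (hSize : ∀ j : Fin k, L ≤ (C j).card ∧ (C j).card ≤ U)
    (c : Fin k → X) (r_opt : ℝ) (hr : 0 ≤ r_opt)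
    (hRad : ∀ j : Fin k, ∀ p ∈ C j, dist p (c j) ≤ r_opt)
    (s : Fin k → X) (hs : ∀ j, s j ∈ P)
    (hGreedy : ∀ j : Fin k, (j : ℕ) ≠ 0 → ∀ p ∈ P,
      sInf ((fun l => dist p (s l)) '' {l : Fin k | l < j}) ≤
        sInf ((fun l => dist (s j) (s l)) '' {l : Fin k | l < j})) :
    ∃ (q : Fin k → X) (σ : {p // p ∈ P} → Fin k),
      (∀ j : Fin k, ∃ i : Fin k, q j = s i) ∧
      (∀ j : Fin k,
        L ≤ ((Finset.univ : Finset {p // p ∈ P}).filter (fun p => σ p = j)).card ∧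
        ((Finset.univ : Finset {p // p ∈ P}).filter (fun p => σ p = j)).card ≤ U) ∧
      ∀ p : {p // p ∈ P}, dist p.1 (q (σ p)) ≤ 4 * r_opt := by
  have hP : ∀ p : {p // p ∈ P}, ∃ j, p.1 ∈ C j := fun p => (hPart p.1).1 p.2
  choose σ hσ using hP
  have hsame : ∀ j, ∀ x ∈ C j, ∀ y ∈ C j, dist x y ≤ 2 * r_opt := by
    intro j x hx y hy
    have h1 := hRad j x hx
    have h2 := hRad j y hy
    have h3 := dist_triangle_right x y (c j)
    linarith
  have huniq : ∀ (p : {p // p ∈ P}) (j : Fin k), p.1 ∈ C j → σ p = j := by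
    intro p j hp
    by_contra hne
    exact Finset.disjoint_left.1 (hDisj _ _ hne) (hσ p) hp
  -- every point is within twice the optimal radius of some greedy center
  have hcover : ∀ p ∈ P, ∃ i, dist p (s i) ≤ 2 * r_opt := by
    intro p hp
    by_cases hinj : Function.Injective (fun i => σ ⟨s i, hs i⟩)
    · obtain ⟨i, hi⟩ := (Finite.injective_iff_surjective.1 hinj) (σ ⟨p, hp⟩)
      refine ⟨i, hsame (σ ⟨p, hp⟩) _ (hσ ⟨p, hp⟩) _ ?_⟩
      rw [← hi]
      exact hσ ⟨s i, hs i⟩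
    · have hab : ∃ a b : Fin k, a < b ∧ σ ⟨s a, hs a⟩ = σ ⟨s b, hs b⟩ := by
        simp only [Function.Injective, not_forall] at hinj
        obtain ⟨a, b, h, hne⟩ := hinj
        rcases lt_or_gt_of_ne hne with h' | h'
        · exact ⟨a, b, h', h⟩
        · exact ⟨b, a, h', h.symm⟩
      obtain ⟨a, b, hlt, heq⟩ := hab
      have hd : dist (s b) (s a) ≤ 2 * r_opt := by
        refine hsame (σ ⟨s b, hs b⟩) _ (hσ ⟨s b, hs b⟩) _ ?_
        rw [← heq]
        exact hσ ⟨s a, hs a⟩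
      have hb0 : (b : ℕ) ≠ 0 := by
        have : (a : ℕ) < b := hlt
        omega
      have hg := hGreedy b hb0 p hp
      have h1 : sInf ((fun l => dist (s b) (s l)) '' {l : Fin k | l < b}) ≤ dist (s b) (s a) :=
        csInf_le (Set.toFinite _).bddBelow ⟨a, hlt, rfl⟩
      have h2 : sInf ((fun l => dist p (s l)) '' {l : Fin k | l < b}) ∈
          ((fun l => dist p (s l)) '' {l : Fin k | l < b}) :=
        Set.Nonempty.csInf_mem ⟨_, a, hlt, rfl⟩ (Set.toFinite _)
      obtain ⟨l, _, hl⟩ := h2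
      exact ⟨l, by simp only at hl; linarith⟩
  have hcenter : ∀ j, ∃ i, ∀ x ∈ C j, dist x (s i) ≤ 4 * r_opt := by
    intro j
    obtain ⟨y, hy⟩ : (C j).Nonempty := Finset.card_pos.1 (by have := (hSize j).1; omega)
    obtain ⟨i, hi⟩ := hcover y ((hPart y).2 ⟨j, hy⟩)
    refine ⟨i, fun x hx => ?_⟩
    have h1 := hsame j x hx y hy
    have h2 := dist_triangle x y (s i)
    linarith
  choose f hf using hcenter
  refine ⟨fun j => s (f j), σ, fun j => ⟨f j, rfl⟩, fun j => ?_, fun p => hf _ _ (hσ p)⟩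
  have hcard : ((Finset.univ : Finset {p // p ∈ P}).filter (fun p => σ p = j)).card
      = (C j).card := by
    refine Finset.card_bij (fun p _ => p.1) ?_ ?_ ?_
    · intro p hp
      rw [← (Finset.mem_filter.1 hp).2]
      exact hσ p
    · intro p _ p' _ h
      exact Subtype.ext h
    · intro x hx
      have hxP := (hPart x).2 ⟨j, hx⟩
      exact ⟨⟨x, hxP⟩, Finset.mem_filter.2 ⟨Finset.mem_univ _, huniq ⟨x, hxP⟩ j hx⟩, rfl⟩
  rw [hcard]
  exact hSize j
end

section
/- Let k ≥ 1 and let L ≤ U be nonnegative integers. For each nonempty subset J ⊆ {1, …, k} let n_J be a nonnegative integer. Suppose there exist nonnegative real numbers x_{J,j}, defined for each nonempty J ⊆ {1, …, k} and each j ∈ J, satisfying: (i) ∑_{j ∈ J} x_{J,j} = n_J for every nonempty J, and (ii) L ≤ ∑_{J : j ∈ J} x_{J,j} ≤ U for every j ∈ {1, …, k}. Then there exist nonnegative integers y_{J,j} (for each nonempty J ⊆ {1, …, k} and each j ∈ J) satisfying the same constraints: ∑_{j ∈ J} y_{J,j} = n_J for every nonempty J, and L ≤ ∑_{J : j ∈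 J} y_{J,j} ≤ U for every j. -/
lemma hall_frac {A B : Type} [Fintype A] [Fintype B] [DecidableEq A] [DecidableEq B]
    (w : A → B → ℝ)
    (h0 : ∀ a b, 0 ≤ w a b) (hr : ∀ a, ∑ b, w a b = 1) (hc : ∀ b, ∑ a, w a b ≤ 1) :
    ∃ f : A → B, Function.Injective f ∧ ∀ a, w a (f a) ≠ 0 := by
  classical
  have key := (Finset.all_card_le_biUnion_card_iff_exists_injective
    (fun a : A => Finset.univ.filter (fun b => w a b ≠ 0))).1 ?_
  · obtain ⟨f, hf, hf2⟩ := key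
    exact ⟨f, hf, fun a => by simpa using hf2 a⟩
  · intro S
    set N := S.biUnion (fun a : A => Finset.univ.filter (fun b => w a b ≠ 0)) with hN
    have h1 : (S.card : ℝ) = ∑ a ∈ S, ∑ b ∈ N, w a b := by
      rw [Finset.card_eq_sum_ones]
      push_cast
      refine Finset.sum_congr rfl fun a ha => ?_
      rw [← hr a]
      symm
      refine Finset.sum_subset (Finset.subset_univ _) fun b _ hb => ?_
      by_contra hne
      exact hb (Finset.mem_biUnion.2 ⟨a, ha, by simpa using hne⟩)
    have h2 : (S.card : ℝ) ≤ N.card := by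
      rw [h1, Finset.sum_comm, Finset.card_eq_sum_ones N]
      push_cast
      refine Finset.sum_le_sum fun b _ => le_trans ?_ (hc b)
      exact Finset.sum_le_sum_of_subset_of_nonneg (Finset.subset_univ _) fun a _ _ => h0 a b
    exact_mod_cast h2

lemma core_round {I K : Type} [Fintype I] [Fintype K] [DecidableEq I] [DecidableEq K]
    (L U : ℕ) (hLU : L ≤ U) (m : I → ℕ) (x : I → K → ℝ) (h0 : ∀ i j, 0 ≤ x i j)
    (h1 : ∀ i, ∑ j, x i j = m i)
    (h2 : ∀ j, (L : ℝ) ≤ ∑ i, x i j ∧ ∑ i, x i j ≤ (U : ℝ)) :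
    ∃ y : I → K → ℕ, (∀ i j, x i j = 0 → y i j = 0) ∧ (∀ i, ∑ j, y i j = m i) ∧
      ∀ j, L ≤ ∑ i, y i j ∧ ∑ i, y i j ≤ U := by
  classical
  obtain ⟨t, ht⟩ : ∃ t : K → ℝ, ∀ j, t j = ∑ i, x i j := ⟨_, fun _ => rfl⟩
  have htL : ∀ j, (L : ℝ) ≤ t j := fun j => by rw [ht]; exact (h2 j).1
  have htU : ∀ j, t j ≤ U := fun j => by rw [ht]; exact (h2 j).2
  have ht0 : ∀ j, 0 ≤ t j := fun j => le_trans (Nat.cast_nonneg _) (htL j)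
  have hxt : ∀ i j, t j = 0 → x i j = 0 := fun i j h => by
    rw [ht] at h
    exact (Finset.sum_eq_zero_iff_of_nonneg (fun i _ => h0 i j)).1 h i (Finset.mem_univ _)
  have hxm : ∀ i j, m i = 0 → x i j = 0 := fun i j h => by
    have h3 := h1 i
    rw [h, Nat.cast_zero] at h3
    exact (Finset.sum_eq_zero_iff_of_nonneg (fun j _ => h0 i j)).1 h3 j (Finset.mem_univ _)
  have hsum : ∑ j, t j = ((∑ i, m i : ℕ) : ℝ) := by
    push_cast
    simp_rw [ht, ← h1]
    exact Finset.sum_comm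
  have hN : ∑ i, m i ≤ Fintype.card K * U := by
    have : ((∑ i, m i : ℕ) : ℝ) ≤ ((Fintype.card K * U : ℕ) : ℝ) := by
      rw [← hsum]
      refine (Finset.sum_le_sum fun j _ => htU j).trans ?_
      simp
    exact_mod_cast this
  obtain ⟨D, hD⟩ := Nat.exists_eq_add_of_le hN
  obtain ⟨g, hg⟩ : ∃ g : K → Fin U → ℝ, ∀ j u, g j u =
    if u.val < L then 1 else (t j - L) / ((U : ℝ) - L) := ⟨_, fun _ _ => rfl⟩
  have hLU' : (L : ℝ) ≤ U := by exact_mod_cast hLU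
  have hg0 : ∀ j u, 0 ≤ g j u := fun j u => by
    rw [hg]; split_ifs
    · norm_num
    · exact div_nonneg (by linarith [htL j]) (by linarith)
  have hg1 : ∀ j u, g j u ≤ 1 := fun j u => by
    rw [hg]; split_ifs
    · norm_num
    · exact div_le_one_of_le₀ (by linarith [htU j]) (by linarith)
  have hgs : ∀ j, ∑ u, g j u = t j := fun j => by
    obtain ⟨d, rfl⟩ := Nat.exists_eq_add_of_le hLU
    simp_rw [hg]
    rw [Fin.sum_univ_add]
    simp
    rcases Nat.eq_zero_or_pos d with h | h
    · subst h
      have := htL j; have := htU j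
      simp at *
      linarith
    · have : (d : ℝ) ≠ 0 := by positivity
      field_simp
      ring
  let w : ((Σ i, Fin (m i)) ⊕ Fin D) → K × Fin U → ℝ := fun p s =>
    match p with
    | Sum.inl p => x p.1 s.1 / m p.1 * (g s.1 s.2 / t s.1)
    | Sum.inr _ => (1 - g s.1 s.2) / D
  have key := hall_frac w ?_ ?_ ?_
  · obtain ⟨f, hf, hw⟩ := key
    have hcard : Fintype.card ((Σ i, Fin (m i)) ⊕ Fin D) = Fintype.card (K × Fin U) := by
      simp [hD]
    have hsurj : Function.Surjective f :=
      ((Fintype.bijective_iff_injective_and_card f).2 ⟨hf, hcard⟩).2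
    have hS : ∀ j, ∑ i, (Finset.univ.filter
        (fun a : Fin (m i) => (f (Sum.inl ⟨i, a⟩)).1 = j)).card =
        (Finset.univ.filter (fun p : (Σ i, Fin (m i)) => (f (Sum.inl p)).1 = j)).card := by
      intro j
      simp_rw [Finset.card_filter]
      rw [Fintype.sum_sigma]
    refine ⟨fun i j => (Finset.univ.filter
        (fun a : Fin (m i) => (f (Sum.inl ⟨i, a⟩)).1 = j)).card, ?_, ?_, ?_⟩
    · intro i j hij
      rw [Finset.card_eq_zero, Finset.filter_eq_empty_iff]
      intro a _ ha
      apply hw (Sum.inl ⟨i, a⟩)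
      simp [w, ha, hij]
    · intro i
      have := Finset.card_eq_sum_card_fiberwise (s := (Finset.univ : Finset (Fin (m i))))
        (t := (Finset.univ : Finset K)) (f := fun a => (f (Sum.inl ⟨i, a⟩)).1)
        (fun _ _ => by simp)
      rw [← this]; simp
    · intro j
      rw [hS]
      constructor
      · have hex : ∀ l : Fin L, ∃ p : (Σ i, Fin (m i)),
            f (Sum.inl p) = (j, Fin.castLE hLU l) := by
          intro l
          obtain ⟨q, hq⟩ := hsurj (j, Fin.castLE hLU l)
          rcases q with p | d
          · exact ⟨p, hq⟩
          · exfalso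
            apply hw (Sum.inr d)
            simp [w, hq, hg]
        choose e he using hex
        have := Finset.card_le_card_of_injOn (s := (Finset.univ : Finset (Fin L)))
          (t := Finset.univ.filter (fun p : (Σ i, Fin (m i)) => (f (Sum.inl p)).1 = j)) e
          (fun l _ => by simp [he]) (fun a _ b _ hab => by
            have h3 := he a
            rw [hab, he b] at h3
            simpa using h3.symm)
        simpa using this
      · have := Finset.card_le_card_of_injOn
          (s := Finset.univ.filter (fun p : (Σ i, Fin (m i)) => (f (Sum.inl p)).1 = j))
          (t := (Finset.univ : Finset (Fin U))) (fun p => (f (Sum.inl p)).2)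
          (fun _ _ => by simp) (fun a ha b hb hab => by
            simp at ha hb
            exact Sum.inl_injective (hf (Prod.ext (ha.trans hb.symm) hab)))
        simpa using this
  · rintro (p | d) s
    · exact mul_nonneg (div_nonneg (h0 _ _) (Nat.cast_nonneg _))
        (div_nonneg (hg0 _ _) (ht0 _))
    · exact div_nonneg (by linarith [hg1 s.1 s.2]) (Nat.cast_nonneg _)
  · rintro (⟨i, a⟩ | d)
    · simp only [w]
      rw [Fintype.sum_prod_type]
      simp_rw [← Finset.mul_sum, ← Finset.sum_div, hgs]
      have hm : (m i : ℝ) ≠ 0 := by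
        have := a.pos
        positivity
      have : ∀ j, x i j / m i * (t j / t j) = x i j / m i := fun j => by
        by_cases h : t j = 0
        · simp [hxt i j h]
        · rw [div_self h, mul_one]
      simp_rw [this]
      rw [← Finset.sum_div, h1, div_self hm]
    · simp only [w]
      rw [Fintype.sum_prod_type]
      have hm : (D : ℝ) ≠ 0 := by
        have := d.pos
        positivity
      simp_rw [← Finset.sum_div, Finset.sum_sub_distrib, hgs]
      rw [hsum, div_eq_one_iff_eq hm]
      have : ((Fintype.card K * U : ℕ) : ℝ) = ((∑ i, m i + D : ℕ) : ℝ) := by rw [hD]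
      push_cast at this ⊢
      simp
      linarith
  · rintro ⟨j, u⟩
    rw [Fintype.sum_sum_type, Fintype.sum_sigma]
    simp only [w]
    simp_rw [Finset.sum_const, Finset.card_univ, Fintype.card_fin, nsmul_eq_mul]
    have e1 : ∀ i, (m i : ℝ) * (x i j / m i * (g j u / t j)) = x i j * (g j u / t j) := by
      intro i
      by_cases h : m i = 0
      · simp [hxm i j h]
      · have : (m i : ℝ) ≠ 0 := by exact_mod_cast h
        field_simp
    simp_rw [e1]
    rw [← Finset.sum_mul, ← ht]
    have e2 : t j * (g j u / t j) ≤ g j u := by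
      by_cases h : t j = 0
      · simp [h, hg0]
      · exact le_of_eq (by field_simp)
    have e3 : (D : ℝ) * ((1 - g j u) / D) ≤ 1 - g j u := by
      by_cases h : (D : ℝ) = 0
      · simp [h, hg1]
      · exact le_of_eq (by field_simp)
    linarith

/-- Lemma 2 of the paper: any feasible nonnegative real solution of the system of
linear equations and inequalities (region equations and cluster-size bounds) can be
transformed into a feasible nonnegative integer solution. -/
theorem stmt_4 (k : ℕ) (hk : 1 ≤ k) (L U : ℕ) (hLU : L ≤ U)
    (n : Finset (Fin k) → ℕ)
    (x : Finset (Fin k) → Fin k → ℝ)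
    (hx0 : ∀ J : Finset (Fin k), J.Nonempty → ∀ j ∈ J, 0 ≤ x J j)
    (hx1 : ∀ J : Finset (Fin k), J.Nonempty → ∑ j ∈ J, x J j = (n J : ℝ))
    (hx2 : ∀ j : Fin k,
      (L : ℝ) ≤ ∑ J ∈ Finset.univ.filter (fun J : Finset (Fin k) => j ∈ J), x J j ∧
      ∑ J ∈ Finset.univ.filter (fun J : Finset (Fin k) => j ∈ J), x J j ≤ (U : ℝ)) :
    ∃ y : Finset (Fin k) → Fin k → ℕ,
      (∀ J : Finset (Fin k), J.Nonempty → ∑ j ∈ J, y J j = n J) ∧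
      ∀ j : Fin k,
        L ≤ ∑ J ∈ Finset.univ.filter (fun J : Finset (Fin k) => j ∈ J), y J j ∧
        ∑ J ∈ Finset.univ.filter (fun J : Finset (Fin k) => j ∈ J), y J j ≤ U := by
  classical
  have key := core_round L U hLU (fun J => if J.Nonempty then n J else 0)
    (fun J j => if j ∈ J then x J j else 0) ?_ ?_ ?_
  · obtain ⟨y, hy0, hy1, hy2⟩ := key
    have hz : ∀ J j, j ∉ J → y J j = 0 := fun J j h => hy0 J j (by simp [h])
    refine ⟨y, fun J hJ => ?_, fun j => ?_⟩
    · have := hy1 J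
      rw [if_pos hJ] at this
      rw [← this]
      exact Finset.sum_subset (Finset.subset_univ _) fun j _ hj => hz J j hj
    · have : ∑ J ∈ Finset.univ.filter (fun J : Finset (Fin k) => j ∈ J), y J j = ∑ J, y J j :=
        Finset.sum_subset (Finset.subset_univ _) fun J _ hj => hz J j (by simpa using hj)
      rw [this]
      exact hy2 j
  · intro J j
    split_ifs with h
    · exact hx0 J ⟨j, h⟩ j h
    · exact le_rfl
  · intro J
    rcases J.eq_empty_or_nonempty with rfl | h
    · simp
    · simp [h, ← hx1 J h]
  · intro j
    simpa only [Finset.sum_filter] using hx2 j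
end

section
/- Let X be a metric space, let P be a finite set of points in X, let q_1, …, q_k ∈ X, let r ≥ 0, and let L ≤ U be nonnegative integers. For each nonempty subset J ⊆ {1, …, k}, let n_J be the number of points p ∈ P such that {j : dist(p, q_j) ≤ r} = J, and assume every point of P lies within distance r of at least one q_j. Then the following are equivalent: (a) there exists an assignment σ : P → {1, …, k} such that dist(p, q_{σ(p)}) ≤ r for every p ∈ P and L ≤ |σ^{−1}(j)| ≤ U for every j; (b) there exist nonnegative real numbers x_{J,j}, defined for each nonempty J ⊆ {1, …, k} and each j ∈ J, satisfying ∑_{j ∈ J} x_{J,j} = n_J for every nonempty J and L ≤ ∑_{J : j ∈ J} x_{J,j} ≤ U for every j. -/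
open scoped Classical

lemma hall_aux {α β : Type*} [Fintype α] [Fintype β] (M : α → β → ℝ)
    (h0 : ∀ a b, 0 ≤ M a b) (hr : ∀ a, ∑ b, M a b = 1) (hc : ∀ b, ∑ a, M a b ≤ 1) :
    ∃ f : α → β, Function.Injective f ∧ ∀ a, 0 < M a (f a) := by
  have key := (Finset.all_card_le_biUnion_card_iff_exists_injective
    (fun a : α => Finset.univ.filter (fun b : β => 0 < M a b))).1 ?_
  · obtain ⟨f, hf, hm⟩ := key
    exact ⟨f, hf, fun a => by simpa using hm a⟩
  intro s
  set N := s.biUnion (fun a : α => Finset.univ.filter (fun b : β => 0 < M a b)) with hN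
  have h1 : (s.card : ℝ) = ∑ a ∈ s, ∑ b ∈ N, M a b := by
    rw [Finset.card_eq_sum_ones]
    push_cast
    refine Finset.sum_congr rfl fun a ha => ?_
    rw [← hr a]
    symm
    refine Finset.sum_subset (Finset.subset_univ _) fun b _ hb => ?_
    by_contra hne
    apply hb
    rw [hN, Finset.mem_biUnion]
    exact ⟨a, ha, by simpa using lt_of_le_of_ne (h0 a b) (Ne.symm hne)⟩
  have h2 : (s.card : ℝ) ≤ N.card := by
    rw [h1, Finset.sum_comm, Finset.card_eq_sum_ones]
    push_cast
    refine Finset.sum_le_sum fun b _ => le_trans ?_ (hc b)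
    exact Finset.sum_le_sum_of_subset_of_nonneg (Finset.subset_univ _) fun a _ _ => h0 a b
  exact_mod_cast h2

lemma round_aux {A : Type*} [Fintype A] (k L U : ℕ) (hLU : L ≤ U) (y : A → Fin k → ℝ)
    (y0 : ∀ a j, 0 ≤ y a j) (yr : ∀ a, ∑ j, y a j = 1)
    (yL : ∀ j, (L : ℝ) ≤ ∑ a, y a j) (yU : ∀ j, ∑ a, y a j ≤ (U : ℝ)) :
    ∃ σ : A → Fin k, (∀ a, 0 < y a (σ a)) ∧
      ∀ j, L ≤ (Finset.univ.filter (fun a => σ a = j)).card ∧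
        (Finset.univ.filter (fun a => σ a = j)).card ≤ U := by
  set c : Fin k → ℝ := fun j => ∑ a, y a j with hc
  have c0 : ∀ j, 0 ≤ c j := fun j => Finset.sum_nonneg fun a _ => y0 a j
  have yc : ∀ a j, c j = 0 → y a j = 0 := fun a j h =>
    (Finset.sum_eq_zero_iff_of_nonneg (fun a _ => y0 a j)).1 h a (Finset.mem_univ a)
  have csum : ∑ j, c j = Fintype.card A := by
    simp only [hc]
    rw [Finset.sum_comm]
    simp [yr]
  have cardle : Fintype.card A ≤ k * U := by
    have : (Fintype.card A : ℝ) ≤ k * U := by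
      rw [← csum]
      refine (Finset.sum_le_sum fun j _ => yU j).trans ?_
      simp
    exact_mod_cast this
  obtain ⟨D, hD⟩ := Nat.exists_eq_add_of_le cardle
  set u : Fin k → Fin U → ℝ := fun j s => if s.1 < L then 1 else (c j - L) / (U - L) with hu
  have u0 : ∀ j s, 0 ≤ u j s := by
    intro j s
    simp only [hu]
    split_ifs
    · norm_num
    · have : (L : ℝ) ≤ U := by exact_mod_cast hLU
      exact div_nonneg (by linarith [yL j]) (by linarith)
  have u1 : ∀ j s, u j s ≤ 1 := by
    intro j s
    simp only [hu]
    split_ifs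
    · norm_num
    · have : (L : ℝ) ≤ U := by exact_mod_cast hLU
      exact div_le_one_of_le₀ (by linarith [yU j]) (by linarith)
  have us : ∀ j, ∑ s, u j s = c j := by
    intro j
    simp only [hu]
    rw [Fin.sum_univ_eq_sum_range (fun s => if s < L then (1:ℝ) else (c j - L) / (U - L)) U]
    rw [← Finset.sum_range_add_sum_Ico _ hLU]
    have e1 : ∑ s ∈ Finset.range L, (if s < L then (1:ℝ) else (c j - L) / (U - L)) = L := by
      rw [Finset.sum_congr rfl (g := fun _ => (1:ℝ))]
      · simp
      · intro s hs
        rw [if_pos (Finset.mem_range.1 hs)]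
    have e2 : ∑ s ∈ Finset.Ico L U, (if s < L then (1:ℝ) else (c j - L) / (U - L))
        = (U - L) * ((c j - L) / (U - L)) := by
      rw [Finset.sum_congr rfl (g := fun _ => (c j - L) / ((U:ℝ) - L))]
      · simp [Nat.cast_sub hLU]
      · intro s hs
        rw [if_neg (not_lt.2 (Finset.mem_Ico.1 hs).1)]
    rw [e1, e2]
    by_cases h : (U : ℝ) - L = 0
    · have h1 := yL j
      have h2 := yU j
      rw [h]
      simp only [hc] at *
      linarith
    · field_simp
      ring
  let M : A ⊕ Fin D → Fin k × Fin U → ℝ := fun a b =>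
    Sum.elim (fun a => y a b.1 / c b.1 * u b.1 b.2) (fun _ => (1 - u b.1 b.2) / D) a
  obtain ⟨f, hf, hM⟩ := hall_aux M (by
      rintro (a | d) ⟨j, s⟩
      · exact mul_nonneg (div_nonneg (y0 a j) (c0 j)) (u0 j s)
      · exact div_nonneg (by simpa using u1 j s) (Nat.cast_nonneg _))
    (by
      rintro (a | d)
      · simp only [M, Sum.elim_inl, Fintype.sum_prod_type, ← Finset.mul_sum, us]
        rw [← yr a]
        refine Finset.sum_congr rfl fun j _ => ?_
        by_cases h : c j = 0
        · simp [yc a j h]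
        · field_simp
      · simp only [M, Sum.elim_inr, Fintype.sum_prod_type, ← Finset.sum_div,
          Finset.sum_sub_distrib, us, csum]
        have hD0 : (D : ℝ) ≠ 0 := by
          have := d.2
          exact_mod_cast (by omega : D ≠ 0)
        have : (k : ℝ) * U = Fintype.card A + D := by exact_mod_cast hD
        rw [div_eq_one_iff_eq hD0]
        simp
        linarith)
    (by
      rintro ⟨j, s⟩
      simp only [M, Fintype.sum_sum_type, Sum.elim_inl, Sum.elim_inr, ← Finset.sum_mul,
        ← Finset.sum_div]
      have e1 : (∑ a, y a j) / c j * u j s ≤ u j s :=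
        mul_le_of_le_one_left (u0 j s) (div_self_le_one _)
      have e2 : ∑ _d : Fin D, (1 - u j s) ≤ (1 - u j s) * D := by
        rw [Finset.sum_const, nsmul_eq_mul, Finset.card_univ, Fintype.card_fin, mul_comm]
      have e3 : (∑ _d : Fin D, (1 - u j s)) / D ≤ 1 - u j s :=
        div_le_of_le_mul₀ (Nat.cast_nonneg _) (by linarith [u1 j s]) e2
      linarith)
  have hbij : Function.Bijective f := by
    rw [Fintype.bijective_iff_injective_and_card]
    exact ⟨hf, by simp [hD]⟩
  refine ⟨fun a => (f (Sum.inl a)).1, fun a => ?_, fun j => ⟨?_, ?_⟩⟩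
  · have := hM (Sum.inl a)
    simp only [M, Sum.elim_inl] at this
    refine lt_of_le_of_ne (y0 _ _) fun h => ?_
    rw [← h] at this
    simp at this
  · have hex : ∀ s : Fin L, ∃ a : A, f (Sum.inl a) = (j, Fin.castLE hLU s) := by
      intro s
      obtain ⟨x, hx⟩ := hbij.2 (j, Fin.castLE hLU s)
      rcases x with a | d
      · exact ⟨a, hx⟩
      · have := hM (Sum.inr d)
        rw [hx] at this
        simp [M, hu] at this
    choose g hg using hex
    have := Finset.card_le_card_of_injOn (s := (Finset.univ : Finset (Fin L)))
      (t := Finset.univ.filter (fun a => (f (Sum.inl a)).1 = j)) g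
      (by intro s _; simp [hg]) (by
        intro s _ t _ hst
        have h1 := hg s
        rw [hst, hg t] at h1
        have := (Prod.ext_iff.1 h1).2
        simpa using this.symm)
    simpa using this
  · have := Finset.card_le_card_of_injOn (t := (Finset.univ : Finset (Fin U)))
      (s := Finset.univ.filter (fun a => (f (Sum.inl a)).1 = j)) (fun a => (f (Sum.inl a)).2)
      (by intro s _; simp) (by
        intro s hs t ht hst
        have h1 : (f (Sum.inl s)).1 = j := by simpa using hs
        have h2 : (f (Sum.inl t)).1 = j := by simpa using ht
        exact Sum.inl_injective (hf (Prod.ext (h1.trans h2.symm) hst)))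
    simpa using this

/-- The combinatorial core, for an abstract neighbourhood map. -/
lemma core_aux {A : Type*} [Fintype A] (k L U : ℕ) (hLU : L ≤ U) (N : A → Finset (Fin k))
    (hN : ∀ a, (N a).Nonempty) (n : Finset (Fin k) → ℕ)
    (hn : ∀ J, n J = (Finset.univ.filter (fun a => N a = J)).card) :
    (∃ σ : A → Fin k, (∀ a, σ a ∈ N a) ∧
        ∀ j : Fin k,
          L ≤ (Finset.univ.filter (fun a => σ a = j)).card ∧
          (Finset.univ.filter (fun a => σ a = j)).card ≤ U) ↔
    (∃ x : Finset (Fin k) → Fin k → ℝ,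
        (∀ J : Finset (Fin k), J.Nonempty → ∀ j ∈ J, 0 ≤ x J j) ∧
        (∀ J : Finset (Fin k), J.Nonempty → ∑ j ∈ J, x J j = (n J : ℝ)) ∧
        ∀ j : Fin k,
          (L : ℝ) ≤ ∑ J ∈ Finset.univ.filter (fun J : Finset (Fin k) => j ∈ J), x J j ∧
          ∑ J ∈ Finset.univ.filter (fun J : Finset (Fin k) => j ∈ J), x J j ≤ (U : ℝ)) := by
  constructor
  · rintro ⟨σ, hσ, hb⟩
    refine ⟨fun J j => ((Finset.univ.filter (fun a => N a = J ∧ σ a = j)).card : ℝ),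
      fun _ _ _ _ => Nat.cast_nonneg _, fun J _ => ?_, fun j => ?_⟩
    · rw [hn, Finset.card_eq_sum_card_fiberwise (f := σ) (t := J)]
      · push_cast
        simp only [Finset.filter_filter]
      · intro a ha
        have : N a = J := by simpa using ha
        rw [← this]
        exact hσ a
    · have : ∑ J ∈ Finset.univ.filter (fun J : Finset (Fin k) => j ∈ J),
          ((Finset.univ.filter (fun a => N a = J ∧ σ a = j)).card : ℝ)
          = ((Finset.univ.filter (fun a => σ a = j)).card : ℝ) := by
        rw [Finset.card_eq_sum_card_fiberwise (f := N)
          (t := Finset.univ.filter (fun J : Finset (Fin k) => j ∈ J))]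
        · push_cast
          simp only [Finset.filter_filter, and_comm]
        · intro a ha
          have : σ a = j := by simpa using ha
          simpa [← this] using hσ a
      simp only [this]
      exact_mod_cast hb j
  · rintro ⟨x, x0, xr, xb⟩
    have npos : ∀ a, (n (N a) : ℝ) ≠ 0 := by
      intro a
      rw [hn]
      have : a ∈ Finset.univ.filter (fun b => N b = N a) := by simp
      exact_mod_cast (Finset.card_pos.2 ⟨a, this⟩).ne'
    let y : A → Fin k → ℝ := fun a j => if j ∈ N a then x (N a) j / n (N a) else 0
    have col : ∀ j, ∑ a, y a j
        = ∑ J ∈ Finset.univ.filter (fun J : Finset (Fin k) => j ∈ J), x J j := by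
      intro j
      rw [← Finset.sum_fiberwise (s := Finset.univ) (g := N), Finset.sum_filter]
      refine Finset.sum_congr rfl fun J _ => ?_
      have e : ∑ a ∈ Finset.univ.filter (fun a => N a = J), y a j
          = ∑ a ∈ Finset.univ.filter (fun a => N a = J), (if j ∈ J then x J j / n J else 0) := by
        refine Finset.sum_congr rfl fun a ha => ?_
        have : N a = J := by simpa using ha
        simp only [y, this]
      rw [e, Finset.sum_const, ← hn]
      split_ifs with hj
      · by_cases h : (n J : ℝ) = 0
        · have h1 := xr J ⟨j, hj⟩
          rw [h] at h1
          have := (Finset.sum_eq_zero_iff_of_nonneg (x0 J ⟨j, hj⟩)).1 h1 j hj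
          simp [this]
        · rw [nsmul_eq_mul]
          field_simp
      · simp
    obtain ⟨σ, h1, h2⟩ := round_aux k L U hLU y
      (by
        intro a j
        simp only [y]
        split_ifs with h
        · exact div_nonneg (x0 _ (hN a) j h) (Nat.cast_nonneg _)
        · exact le_rfl)
      (by
        intro a
        simp only [y]
        rw [← Finset.sum_filter]
        simp only [Finset.filter_mem_eq_inter, Finset.univ_inter]
        rw [← Finset.sum_div, xr _ (hN a), div_self (npos a)])
      (fun j => by rw [col]; exact (xb j).1) (fun j => by rw [col]; exact (xb j).2)
    refine ⟨σ, fun a => ?_, h2⟩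
    by_contra h
    have := h1 a
    simp [y, h] at this

/-- Section 2.2 of the paper: for fixed centers `q 0, …, q (k-1)` and radius `r`,
a balanced assignment of the points of `P` within radius `r` exists if and only if
the system of linear equations and inequalities (over the regions of the ball
arrangement) has a nonnegative real feasible solution. -/
theorem stmt_5 {X : Type*} [MetricSpace X] (k : ℕ) (P : Finset X)
    (q : Fin k → X) (r : ℝ) (hr : 0 ≤ r) (L U : ℕ) (hLU : L ≤ U)
    (hcov : ∀ p ∈ P, ∃ j : Fin k, dist p (q j) ≤ r)
    (n : Finset (Fin k) → ℕ)
    (hn : ∀ J : Finset (Fin k),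
      n J = (P.filter (fun p =>
        (Finset.univ.filter (fun j : Fin k => dist p (q j) ≤ r)) = J)).card) :
    (∃ σ : {p // p ∈ P} → Fin k,
        (∀ p : {p // p ∈ P}, dist p.1 (q (σ p)) ≤ r) ∧
        ∀ j : Fin k,
          L ≤ ((Finset.univ : Finset {p // p ∈ P}).filter (fun p => σ p = j)).card ∧
          ((Finset.univ : Finset {p // p ∈ P}).filter (fun p => σ p = j)).card ≤ U) ↔
    (∃ x : Finset (Fin k) → Fin k → ℝ,
        (∀ J : Finset (Fin k), J.Nonempty → ∀ j ∈ J, 0 ≤ x J j) ∧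
        (∀ J : Finset (Fin k), J.Nonempty → ∑ j ∈ J, x J j = (n J : ℝ)) ∧
        ∀ j : Fin k,
          (L : ℝ) ≤ ∑ J ∈ Finset.univ.filter (fun J : Finset (Fin k) => j ∈ J), x J j ∧
          ∑ J ∈ Finset.univ.filter (fun J : Finset (Fin k) => j ∈ J), x J j ≤ (U : ℝ)) := by
  have key := core_aux (A := {p // p ∈ P}) k L U hLU
    (fun p => Finset.univ.filter (fun j : Fin k => dist p.1 (q j) ≤ r))
    (fun p => by
      obtain ⟨j, hj⟩ := hcov p.1 p.2
      exact ⟨j, by simpa using hj⟩) n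
    (fun J => by
      rw [hn]
      symm
      refine Finset.card_bij (fun a _ => a.1) ?_ ?_ ?_
      · intro a ha
        exact Finset.mem_filter.2 ⟨a.2, (Finset.mem_filter.1 ha).2⟩
      · intro a _ b _ h
        exact Subtype.ext h
      · intro b hb
        exact ⟨⟨b, (Finset.mem_filter.1 hb).1⟩,
          Finset.mem_filter.2 ⟨Finset.mem_univ _, (Finset.mem_filter.1 hb).2⟩, rfl⟩)
  rw [← key]
  simp only [Finset.mem_filter, Finset.mem_univ, true_and]
end

section
/- Let 0 < δ < 1 and consider the six points p_1 = 0, p_2 = 2, p_3 = 4 − δ, p_4 = 6 − δ, p_5 = 8 − 2δ, p_6 = 8 − 2δ on the real line (with the absolute-value metric), with k = 3 clusters and balance bounds L = U = 2. Then: (a) there exists an assignment σ of the six points to 3 clusters with exactly 2 points per cluster and real centers c_1, c_2, c_3 such that |p_i − c_{σ(i)}| ≤ 1 for every i (so the optimal balanced radius is at most 1); and (b) for the set S = {p_1, p_2, p_5} = {0, 2, 8 − 2δ}, for every choice of centers q_1, q_2, q_3 ∈ S (repetitions allowed) and every assignment σ of the six points to 3 clusters with exactly 2 points per cluster, there is some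 point p_i with |p_i − q_{σ(i)}| ≥ 4 − δ. Consequently the approximation ratio achieved using centers from S^3 on this instance is at least 4 − δ. -/
/-- In a balanced assignment of six points to three clusters, some cluster contains both one of
the first three points and one of the last three points. -/
lemma exists_mixed (σ : Fin 6 → Fin 3)
    (h : ∀ j : Fin 3, (Finset.univ.filter (fun i : Fin 6 => σ i = j)).card = 2) :
    ∃ i j : Fin 6, i < 3 ∧ 3 ≤ j ∧ σ i = σ j := by
  by_contra hne
  have hne' : ∀ i j : Fin 6, i < 3 → 3 ≤ j → σ i ≠ σ j :=
    fun i j hi hj he => hne ⟨i, j, hi, hj, he⟩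
  have key : ∀ a b c d e f : Fin 3, a ≠ d → a ≠ e → a ≠ f → b ≠ d → b ≠ e → b ≠ f →
      c ≠ d → c ≠ e → c ≠ f → (a = b ∧ b = c) ∨ (d = e ∧ e = f) := by decide
  have three : ∀ i j k : Fin 6, i ≠ j → i ≠ k → j ≠ k → σ i = σ j → σ j = σ k → False := by
    intro i j k hij hik hjk h1 h2
    have hsub : ({i, j, k} : Finset (Fin 6)) ⊆
        Finset.univ.filter (fun l : Fin 6 => σ l = σ k) := by
      intro l hl
      simp only [Finset.mem_insert, Finset.mem_singleton] at hl
      rcases hl with rfl | rfl | rfl <;> simp [h1, h2]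
    have hc := Finset.card_le_card hsub
    rw [h, Finset.card_eq_three.mpr ⟨i, j, k, hij, hik, hjk, rfl⟩] at hc
    omega
  rcases key (σ 0) (σ 1) (σ 2) (σ 3) (σ 4) (σ 5)
    (hne' _ _ (by decide) (by decide)) (hne' _ _ (by decide) (by decide))
    (hne' _ _ (by decide) (by decide)) (hne' _ _ (by decide) (by decide))
    (hne' _ _ (by decide) (by decide)) (hne' _ _ (by decide) (by decide))
    (hne' _ _ (by decide) (by decide)) (hne' _ _ (by decide) (by decide))
    (hne' _ _ (by decide) (by decide)) with ⟨h1, h2⟩ | ⟨h1, h2⟩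
  · exact three 0 1 2 (by decide) (by decide) (by decide) h1 h2
  · exact three 3 4 5 (by decide) (by decide) (by decide) h1 h2

/-- The tightness example of Section 3 (Fig. 5): for the six points
`0, 2, 4 - δ, 6 - δ, 8 - 2δ, 8 - 2δ` on the line with `k = 3` and `L = U = 2`,
(a) there is a balanced clustering (exactly two points per cluster) of radius at
most `1`; and (b) for every choice of three centers from `S = {0, 2, 8 - 2δ}` and
every balanced assignment, some point lies at distance at least `4 - δ` from its
center. Hence the approximation ratio `4` is tight. -/
theorem stmt_7 (δ : ℝ) (hδ0 : 0 < δ) (hδ1 : δ < 1) :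
    let p : Fin 6 → ℝ := ![0, 2, 4 - δ, 6 - δ, 8 - 2 * δ, 8 - 2 * δ]
    (∃ (σ : Fin 6 → Fin 3) (c : Fin 3 → ℝ),
      (∀ j : Fin 3, (Finset.univ.filter (fun i : Fin 6 => σ i = j)).card = 2) ∧
      ∀ i : Fin 6, dist (p i) (c (σ i)) ≤ 1) ∧
    ∀ q : Fin 3 → ℝ, (∀ m : Fin 3, q m ∈ ({0, 2, 8 - 2 * δ} : Set ℝ)) →
      ∀ σ : Fin 6 → Fin 3,
        (∀ j : Fin 3, (Finset.univ.filter (fun i : Fin 6 => σ i = j)).card = 2) →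
        ∃ i : Fin 6, 4 - δ ≤ dist (p i) (q (σ i)) := by
  intro p
  refine ⟨⟨![0, 0, 1, 1, 2, 2], ![1, 5 - δ, 8 - 2 * δ], by decide, ?_⟩, ?_⟩
  · intro i
    rw [Real.dist_eq, abs_le]
    fin_cases i <;> simp [p] <;> (try constructor) <;> linarith
  · intro q hq σ hσ
    obtain ⟨i, j, hi, hj, hij⟩ := exists_mixed σ hσ
    have low : p i ≤ 4 - δ := by
      fin_cases i <;> simp [p] at hi ⊢ <;> first | linarith | (exfalso; revert hi; decide)
    have high : 6 - δ ≤ p j := by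
      fin_cases j <;> simp [p] at hj ⊢ <;> first | linarith | (exfalso; revert hj; decide)
    have hm := hq (σ j)
    simp only [Set.mem_insert_iff, Set.mem_singleton_iff] at hm
    rcases hm with hm | hm | hm
    · refine ⟨j, ?_⟩
      rw [hm, Real.dist_eq]
      exact le_trans (by linarith) (le_abs_self _)
    · refine ⟨j, ?_⟩
      rw [hm, Real.dist_eq]
      exact le_trans (by linarith) (le_abs_self _)
    · refine ⟨i, ?_⟩
      rw [hij, hm, Real.dist_eq]
      exact le_trans (by linarith) (neg_le_abs _)
end

section
/- Let l, r, h be positive reals with l < 2r < h, and consider the six points in the plane ℝ²: p_1 = p_2 = (0, 0), p_3 = p_4 = (0, l), p_5 = (h, 0), p_6 = (h, 2r), with k = 3 clusters and balance bounds L = U = 2. Then: (a) there exists a balanced clustering of radius at most r, namely clusters {p_1, p_2}, {p_3, p_4}, {p_5, p_6} with suitable centers; and (b) for every assignment σ of the six indexed points to 3 clusters with exactly 2 points per cluster, taking the centers to be q_1 = p_1, q_2 = p_5, q_3 = p_6 (the three points selected by Gonzalez's algorithm), some point p_i satisfies dist(p_i, q_{σ(i)}) ≥ h. Consequently, using the selected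 points S directly as the cluster centers gives approximation ratio at least h/r, which can be made arbitrarily large. -/
/-- The example of Section 3 (Fig. 6): for the six planar points
`p₁ = p₂ = (0,0)`, `p₃ = p₄ = (0,l)`, `p₅ = (h,0)`, `p₆ = (h,2r)` with
`l < 2r < h`, `k = 3` and `L = U = 2`:
(a) there is a balanced clustering (exactly two points per cluster) of radius at
most `r`; and (b) using the three points `p₁, p₅, p₆` selected by Gonzalez's
algorithm directly as the centers, every balanced assignment has some point at
distance at least `h` from its center. -/
theorem stmt_8 (l r h : ℝ) (hl : 0 < l) (hr : 0 < r) (hh : 0 < h)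
    (hlr : l < 2 * r) (hrh : 2 * r < h) :
    let p : Fin 6 → EuclideanSpace ℝ (Fin 2) :=
      ![(WithLp.equiv 2 (Fin 2 → ℝ)).symm ![0, 0],
        (WithLp.equiv 2 (Fin 2 → ℝ)).symm ![0, 0],
        (WithLp.equiv 2 (Fin 2 → ℝ)).symm ![0, l],
        (WithLp.equiv 2 (Fin 2 → ℝ)).symm ![0, l],
        (WithLp.equiv 2 (Fin 2 → ℝ)).symm ![h, 0],
        (WithLp.equiv 2 (Fin 2 → ℝ)).symm ![h, 2 * r]]
    (∃ (σ : Fin 6 → Fin 3) (c : Fin 3 → EuclideanSpace ℝ (Fin 2)),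
      (∀ j : Fin 3, (Finset.univ.filter (fun i : Fin 6 => σ i = j)).card = 2) ∧
      ∀ i : Fin 6, dist (p i) (c (σ i)) ≤ r) ∧
    ∀ σ : Fin 6 → Fin 3,
      (∀ j : Fin 3, (Finset.univ.filter (fun i : Fin 6 => σ i = j)).card = 2) →
      ∃ i : Fin 6, h ≤ dist (p i) (![p 0, p 4, p 5] (σ i)) := by
  intro p
  refine ⟨⟨![0, 0, 1, 1, 2, 2], ![p 0, p 2, (WithLp.equiv 2 (Fin 2 → ℝ)).symm ![h, r]],
    by decide, ?_⟩, ?_⟩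
  · have e : Real.sqrt (r ^ 2) = r := Real.sqrt_sq hr.le
    have e2 : (2 * r - r) ^ 2 = r ^ 2 := by ring
    intro i
    fin_cases i <;>
      simp [p, EuclideanSpace.dist_eq, Fin.sum_univ_two, Real.dist_eq, sq_abs, e, e2, hr.le]
  · intro σ hσ
    have key : ∃ i : Fin 6, (i = 0 ∨ i = 1 ∨ i = 2) ∧ σ i ≠ 0 := by
      by_contra hcon
      push Not at hcon
      have hsub : ({0, 1, 2} : Finset (Fin 6)) ⊆
          Finset.univ.filter (fun i : Fin 6 => σ i = 0) := by
        intro i hi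
        simp only [Finset.mem_insert, Finset.mem_singleton] at hi
        simpa using hcon i hi
      have hc := Finset.card_le_card hsub
      rw [hσ 0] at hc
      exact absurd hc (by decide)
    obtain ⟨i, hi, hne⟩ := key
    refine ⟨i, ?_⟩
    have h0 : (p i) 0 = 0 := by
      rcases hi with rfl | rfl | rfl <;> simp [p]
    have h1 : (![p 0, p 4, p 5] (σ i)) 0 = h := by
      generalize σ i = j at hne
      fin_cases j
      · exact absurd rfl hne
      · simp [p]
      · simp [p]
    rw [EuclideanSpace.dist_eq, Fin.sum_univ_two, h0, h1]
    apply Real.le_sqrt_of_sq_le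
    have e : dist (0 : ℝ) h ^ 2 = h ^ 2 := by simp [Real.dist_eq]
    rw [e]
    exact le_add_of_nonneg_right (sq_nonneg _)
end
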